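/- Let M be a compact smooth m-dimensional submanifold of R^d with reach at least 1, and let P be a uniform (ε,κ)-sample of M. Then for any x ∈ R^d and any t ∈ [1, 1/√(2ε)], the number of points of P inside the closed ball B(x, tε) is at most (4t+1)^m · κ. -/

import Mathlib

open Metric Set

/-- The medial axis of a set `M`. -/
def medialAxis {d : ℕ} (M : Set (EuclideanSpace ℝ (Fin d))) : Set (EuclideanSpace ℝ (Fin d)) :=
  closure {x | ∃ y ∈ M, ∃ z ∈ M, y ≠ z ∧
    dist x y = Metric.infDist x M ∧ dist x z = Metric.infDist x M}

open Filter Topology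
open scoped RealInnerProductSpace

section PositiveReach

variable {E : Type*} [NormedAddCommGroup E] [InnerProductSpace ℝ E] {M : Set E}

/-- Moving away from the unique nearest point of a compact set increases the distance to the
set. -/
theorem eventually_lt_infDist_add_smul (hM : IsCompact M) {w q : E} (hq : q ∈ M)
    (hwq : dist w q = infDist w M)
    (huniq : ∀ p ∈ M, dist w p = infDist w M → p = q) {v : E} (hv : 0 < ⟪w - q, v⟫) :
    ∀ᶠ s : ℝ in 𝓝[>] 0, infDist w M < infDist (w + s • v) M := by
  have hMne : M.Nonempty := ⟨q, hq⟩
  set K : Set E := M ∩ {p | ⟪w - p, v⟫ ≤ 0} with hK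
  have hKc : IsCompact K := hM.inter_right (isClosed_le (by fun_prop) continuous_const)
  have hgap : ∃ η > 0, ∀ p ∈ K, infDist w M + η ≤ dist w p := by
    rcases K.eq_empty_or_nonempty with h | h
    · exact ⟨1, one_pos, by simp [h]⟩
    · obtain ⟨p, hpK, hp⟩ := hKc.exists_infDist_eq_dist h w
      refine ⟨dist w p - infDist w M, ?_, fun p' hp' => ?_⟩
      · rcases (infDist_le_dist_of_mem (x := w) hpK.1).lt_or_eq with h1 | h1
        · linarith
        · have := huniq p hpK.1 h1.symm
          subst this
          exact absurd hpK.2 (not_le.2 hv)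
      · have := infDist_le_dist_of_mem (x := w) hp'
        linarith
  obtain ⟨η, hη, hgap⟩ := hgap
  have hsmall : ∀ᶠ s : ℝ in 𝓝[>] 0, ‖s • v‖ < η := by
    have : Tendsto (fun s : ℝ => ‖s • v‖) (𝓝 0) (𝓝 ‖(0 : ℝ) • v‖) :=
      Continuous.tendsto (by fun_prop) 0
    rw [zero_smul, norm_zero] at this
    exact (this.mono_left nhdsWithin_le_nhds).eventually (gt_mem_nhds hη)
  filter_upwards [hsmall, self_mem_nhdsWithin] with s hs hs0
  have hs0 : 0 < s := hs0
  obtain ⟨p, hpM, hp⟩ := hM.exists_infDist_eq_dist hMne (w + s • v)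
  rw [hp]
  by_cases hpv : ⟪w - p, v⟫ ≤ 0
  · have h1 := hgap p ⟨hpM, hpv⟩
    have h2 : dist w p ≤ dist w (w + s • v) + dist (w + s • v) p := dist_triangle _ _ _
    rw [dist_self_add_right] at h2
    linarith
  · push Not at hpv
    refine (infDist_le_dist_of_mem hpM).trans_lt ?_
    rw [dist_eq_norm, dist_eq_norm, show w + s • v - p = (w - p) + s • v by abel]
    refine lt_of_pow_lt_pow_left₀ 2 (norm_nonneg _) ?_
    rw [norm_add_sq_real, real_inner_smul_right]
    nlinarith [mul_pos hs0 hpv, sq_nonneg ‖s • v‖]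

/-- If all points at distance less than one from the compact set `M` have a unique nearest point,
then the distance to `M` grows at unit rate. -/
theorem exists_infDist_eq_add [ProperSpace E] (hM : IsCompact M) (hMne : M.Nonempty)
    (huniq : ∀ x, infDist x M < 1 → ∀ y ∈ M, ∀ z ∈ M, dist x y = infDist x M →
      dist x z = infDist x M → y = z)
    {y : E} {h : ℝ} (hh : 0 < h) (hhy : h < infDist y M) (hy1 : infDist y M + h < 1) :
    ∃ w, dist w y = h ∧ infDist w M = infDist y M + h := by
  obtain ⟨w, hw, hmax⟩ := (isCompact_closedBall y h).exists_isMaxOn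
    ⟨y, mem_closedBall_self hh.le⟩ (continuous_infDist_pt M).continuousOn
  have hle : infDist w M ≤ infDist y M + h :=
    infDist_le_infDist_add_dist.trans (by gcongr; exact hw)
  have hge : infDist y M ≤ infDist w M := hmax (mem_closedBall_self hh.le)
  obtain ⟨q, hq, hwq⟩ := hM.exists_infDist_eq_dist hMne w
  have hescape : ∀ v, 0 < ⟪w - q, v⟫ → ¬ ∀ᶠ s : ℝ in 𝓝[>] 0, w + s • v ∈ closedBall y h := by
    intro v hv hev
    have h1 := eventually_lt_infDist_add_smul hM hq hwq.symm
      (fun p hp hp' => huniq w (by linarith) p hp q hq hp' hwq.symm) hv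
    obtain ⟨s, hs1, hs2⟩ := (h1.and hev).exists
    exact absurd (hmax hs2) (not_le.2 hs1)
  rw [dist_eq_norm] at hwq
  have ha : 0 < ‖w - q‖ := by linarith
  have hb : ‖w - y‖ = h := by
    rw [mem_closedBall, dist_eq_norm] at hw
    refine hw.antisymm (not_lt.1 fun hlt => ?_)
    refine hescape (w - q) (by rw [real_inner_self_eq_norm_sq]; positivity) ?_
    have : Tendsto (fun s : ℝ => w + s • (w - q)) (𝓝 0) (𝓝 (w + (0 : ℝ) • (w - q))) :=
      Continuous.tendsto (by fun_prop) 0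
    rw [zero_smul, add_zero] at this
    refine (this.mono_left nhdsWithin_le_nhds).eventually (closedBall_mem_nhds_of_mem ?_)
    rwa [mem_ball, dist_eq_norm]
  have hinner : ⟪w - q, w - y⟫ = ‖w - q‖ * ‖w - y‖ := by
    refine (real_inner_le_norm _ _).antisymm (not_lt.1 fun hlt => ?_)
    set a := w - q
    set b := w - y
    set v := ‖b‖ • a - ‖a‖ • b with hv
    have hbv : ⟪b, v⟫ < 0 := by
      rw [hv, inner_sub_right, real_inner_smul_right, real_inner_smul_right,
        real_inner_self_eq_norm_sq, real_inner_comm]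
      nlinarith [mul_lt_mul_of_pos_left hlt (hb ▸ hh : 0 < ‖b‖)]
    refine hescape v ?_ ?_
    · rw [hv, inner_sub_right, real_inner_smul_right, real_inner_smul_right,
        real_inner_self_eq_norm_sq]
      nlinarith [mul_lt_mul_of_pos_left hlt ha]
    · have : Tendsto (fun s : ℝ => 2 * ⟪b, v⟫ + s * ‖v‖ ^ 2) (𝓝 0)
          (𝓝 (2 * ⟪b, v⟫ + 0 * ‖v‖ ^ 2)) := Continuous.tendsto (by fun_prop) 0
      filter_upwards [(this.mono_left nhdsWithin_le_nhds).eventually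
        (gt_mem_nhds (by linarith : 2 * ⟪b, v⟫ + 0 * ‖v‖ ^ 2 < 0)), self_mem_nhdsWithin]
        with s hs hs0
      have hs0 : 0 < s := hs0
      rw [mem_closedBall, dist_eq_norm, show w + s • v - y = b + s • v by simp only [b]; abel]
      refine le_of_sq_le_sq ?_ hh.le
      rw [norm_add_sq_real, real_inner_smul_right, norm_smul, mul_pow, Real.norm_eq_abs, sq_abs, hb]
      nlinarith [mul_pos hs0 (neg_pos.2 hs)]
  refine ⟨w, by rw [dist_eq_norm, hb], hle.antisymm ?_⟩
  have hyq : ‖y - q‖ ≤ ‖w - q‖ - h := by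
    refine le_of_sq_le_sq ?_ (by linarith)
    rw [show y - q = (w - q) - (w - y) by abel, norm_sub_sq_real, hinner, hb]
    nlinarith
  have := infDist_le_dist_of_mem (x := y) hq
  rw [dist_eq_norm] at this
  linarith

/-- Along the ray from a point `z` of `M` in a unit normal direction, the distance to `M` is the
distance to `z` up to distance one. -/
theorem infDist_add_smul_eq [ProperSpace E] (hM : IsCompact M)
    (huniq : ∀ x, infDist x M < 1 → ∀ y ∈ M, ∀ z ∈ M, dist x y = infDist x M →
      dist x z = infDist x M → y = z)
    {z n : E} (hz : z ∈ M) (hn : ‖n‖ = 1) {r b : ℝ} (hr : 0 < r) (hrb : r ≤ b) (hb : b < 1)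
    (hzr : infDist (z + r • n) M = r) : infDist (z + b • n) M = b := by
  have hsub : Icc r b ⊆ {s : ℝ | infDist (z + s • n) M = s} := by
    refine IsClosed.Icc_subset_of_forall_exists_gt ?_ hzr ?_
    · refine IsClosed.inter (isClosed_eq ?_ continuous_id) isClosed_Icc
      exact (continuous_infDist_pt M).comp (by fun_prop)
    · rintro s ⟨hs, hrs, hsb⟩ t ht
      have hs : infDist (z + s • n) M = s := hs
      have ht : s < t := ht
      obtain ⟨h, hh0, hh⟩ := exists_between
        (lt_min (lt_min (hr.trans_le hrs) (by linarith : 0 < 1 - s)) (sub_pos.2 ht))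
      rw [lt_min_iff, lt_min_iff] at hh
      obtain ⟨w, hwy, hw⟩ := exists_infDist_eq_add hM ⟨z, hz⟩ huniq (y := z + s • n) hh0
        (by rw [hs]; exact hh.1.1) (by rw [hs]; linarith [hh.1.2])
      rw [hs] at hw
      have hle := infDist_le_dist_of_mem (x := w) hz
      set c := w - (z + s • n) with hc
      rw [dist_eq_norm, ← hc] at hwy
      rw [hw, dist_eq_norm, show w - z = c + s • n by rw [hc]; abel] at hle
      have hs0 : 0 < s := hr.trans_le hrs
      have hsq := pow_le_pow_left₀ (by positivity) hle 2
      rw [norm_add_sq_real, real_inner_smul_right, norm_smul, mul_pow, Real.norm_eq_abs, sq_abs,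
        hn, hwy] at hsq
      have hin : h ≤ ⟪c, n⟫ := by
        by_contra! hcon
        nlinarith [mul_lt_mul_of_pos_left hcon hs0]
      have hcn : ‖c - h • n‖ ^ 2 ≤ 0 := by
        rw [norm_sub_sq_real, real_inner_smul_right, norm_smul, mul_pow, Real.norm_eq_abs, sq_abs,
          hn, hwy]
        nlinarith
      have hcn : c - h • n = 0 := by
        rw [← norm_eq_zero]
        exact pow_eq_zero_iff two_ne_zero |>.1 (hcn.antisymm (sq_nonneg _))
      refine ⟨s + h, ?_, by linarith, by linarith [hh.2]⟩
      change infDist (z + (s + h) • n) M = s + h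
      have hwz : z + (s + h) • n = w := by
        rw [add_smul, ← sub_eq_zero, ← neg_eq_zero, ← hcn, hc]
        abel
      rw [hwz, hw]
  exact hsub (right_mem_Icc.2 hrb)

/-- Federer's inequality for the nearest point `z` of `x` on a set with unique nearest points. -/
theorem inner_sub_nearest_le [ProperSpace E] (hM : IsCompact M)
    (huniq : ∀ x, infDist x M < 1 → ∀ y ∈ M, ∀ z ∈ M, dist x y = infDist x M →
      dist x z = infDist x M → y = z)
    {x z p : E} (hx : infDist x M < 1) (hz : z ∈ M) (hxz : dist x z = infDist x M) (hp : p ∈ M) :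
    ⟪x - z, p - z⟫ ≤ ‖x - z‖ * ‖p - z‖ ^ 2 / 2 := by
  rcases eq_or_ne x z with rfl | hne
  · simp
  set r := ‖x - z‖ with hr
  have hr0 : 0 < r := norm_pos_iff.2 (sub_ne_zero.2 hne)
  have hxr : infDist x M = r := by rw [← hxz, dist_eq_norm]
  set n := r⁻¹ • (x - z) with hn
  have hrn : x - z = r • n := by rw [hn, smul_inv_smul₀ hr0.ne']
  have hn1 : ‖n‖ = 1 := by
    rw [hn, norm_smul, norm_inv, norm_norm, ← hr, inv_mul_cancel₀ hr0.ne']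
  have hIoo : Ioo r 1 ⊆ {b : ℝ | 2 * b * ⟪n, p - z⟫ ≤ ‖p - z‖ ^ 2} := by
    rintro b ⟨hrb, hb⟩
    have h1 := infDist_add_smul_eq hM huniq hz hn1 hr0 hrb.le hb
      (by rw [← hrn, add_sub_cancel, hxr])
    have h2 := infDist_le_dist_of_mem (x := z + b • n) hp
    rw [h1, dist_eq_norm, show z + b • n - p = b • n - (p - z) by abel] at h2
    have h3 := pow_le_pow_left₀ (hr0.trans hrb).le h2 2
    rw [norm_sub_sq_real, real_inner_smul_left, norm_smul, mul_pow, Real.norm_eq_abs, sq_abs,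
      hn1] at h3
    change 2 * b * ⟪n, p - z⟫ ≤ ‖p - z‖ ^ 2
    linarith
  have hcl : (1 : ℝ) ∈ {b : ℝ | 2 * b * ⟪n, p - z⟫ ≤ ‖p - z‖ ^ 2} := by
    refine closure_minimal hIoo (isClosed_le (by fun_prop) continuous_const) ?_
    rw [closure_Ioo (by linarith)]
    exact ⟨by linarith, le_rfl⟩
  have hcl : 2 * 1 * ⟪n, p - z⟫ ≤ ‖p - z‖ ^ 2 := hcl
  rw [hrn, real_inner_smul_left]
  nlinarith

/-- Federer's bound on the distance from a chord to the tangent cone. -/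
theorem exists_mem_tangentConeAt_norm_sub_le [ProperSpace E] (hM : IsCompact M)
    (huniq : ∀ x, infDist x M < 1 → ∀ y ∈ M, ∀ z ∈ M, dist x y = infDist x M →
      dist x z = infDist x M → y = z)
    {z p : E} (hz : z ∈ M) (hp : p ∈ M) :
    ∃ u ∈ tangentConeAt ℝ M z, ‖p - z - u‖ ≤ ‖p - z‖ ^ 2 / 2 := by
  set s : ℕ → ℝ := fun k => 1 / ((k : ℝ) + 1) with hs
  have hs0 : ∀ k, 0 < s k := fun k => by positivity
  have hs1 : ∀ k, s k ≤ 1 := fun k => by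
    rw [hs]
    exact (div_le_one (by positivity)).2 (by linarith [k.cast_nonneg (α := ℝ)])
  have hslim : Tendsto s atTop (𝓝 0) := tendsto_one_div_add_atTop_nhds_zero_nat
  choose q hqM hq using fun k => hM.exists_infDist_eq_dist ⟨z, hz⟩ (z + s k • (p - z))
  set u : ℕ → E := fun k => (s k)⁻¹ • (q k - z) with hu
  have hqu : ∀ k, q k - z = s k • u k := fun k => by
    rw [hu, smul_inv_smul₀ (hs0 k).ne']
  have hyz : ∀ k, infDist (z + s k • (p - z)) M ≤ s k * ‖p - z‖ := fun k => by
    refine (infDist_le_dist_of_mem hz).trans_eq ?_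
    rw [dist_eq_norm, add_sub_cancel_left, norm_smul, Real.norm_of_nonneg (hs0 k).le]
  have hyq : ∀ k, z + s k • (p - z) - q k = s k • (p - z - u k) := fun k => by
    rw [smul_sub _ (p - z), ← hqu]
    abel
  have hpu : ∀ k, ‖p - z - u k‖ ≤ ‖p - z‖ := fun k => by
    have := hyz k
    rw [hq, dist_eq_norm, hyq, norm_smul, Real.norm_of_nonneg (hs0 k).le] at this
    exact le_of_mul_le_mul_left this (hs0 k)
  have hub : ∀ k, ‖u k‖ ≤ 2 * ‖p - z‖ := fun k => by
    have := norm_sub_le (p - z) (p - z - u k)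
    rw [sub_sub_cancel] at this
    linarith [hpu k]
  obtain ⟨v, -, φ, hφ, hv⟩ := (isCompact_closedBall (0 : E) (2 * ‖p - z‖)).tendsto_subseq
    (fun k => by simpa using hub k : ∀ k, u k ∈ closedBall (0 : E) (2 * ‖p - z‖))
  have hsφ : Tendsto (s ∘ φ) atTop (𝓝 0) := hslim.comp hφ.tendsto_atTop
  have hsuφ : Tendsto (fun k => s (φ k) • u (φ k)) atTop (𝓝 0) := by
    simpa using hsφ.smul hv
  refine ⟨v, ?_, ?_⟩
  · refine mem_tangentConeAt_of_seq atTop (fun k => (s (φ k))⁻¹) (fun k => q (φ k) - z) ?_ ?_ hv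
    · simpa only [hqu] using hsuφ
    · exact Eventually.of_forall fun k => by simpa using hqM (φ k)
  · have hlim : Tendsto (fun k => ((1 - s (φ k)) * s (φ k) * (2 * ‖p - z‖) ^ 2 +
        ‖p - z - s (φ k) • u (φ k)‖ ^ 2) / 2) atTop
        (𝓝 (((1 - 0) * 0 * (2 * ‖p - z‖) ^ 2 + ‖p - z - 0‖ ^ 2) / 2)) :=
      ((((tendsto_const_nhds.sub hsφ).mul hsφ).mul_const _).add
        ((tendsto_const_nhds.sub hsuφ).norm.pow 2)).div_const 2
    rw [sub_zero, sub_zero, mul_zero, zero_mul, zero_add] at hlim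
    refine le_of_tendsto_of_tendsto (tendsto_const_nhds.sub hv).norm hlim ?_
    have hsm : ∀ᶠ k in atTop, s (φ k) * ‖p - z‖ < 1 := by
      have := hsφ.mul_const ‖p - z‖
      rw [zero_mul] at this
      exact this.eventually (gt_mem_nhds one_pos)
    filter_upwards [hsm] with k hk
    simp only [Function.comp_apply]
    generalize φ k = j at hk
    have hlt := (hyz j).trans_lt hk
    have h1 := inner_sub_nearest_le hM huniq hlt (hqM j) (hq j).symm hz
    have h2 := inner_sub_nearest_le hM huniq hlt (hqM j) (hq j).symm hp
    have hs0j := hs0 j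
    have hs1j := hs1 j
    have hubj := hub j
    have hzq : z - q j = -(s j • u j) := by rw [← hqu]; abel
    have hpq : p - q j = p - z - s j • u j := by rw [← hqu]; abel
    rw [hyq, hzq, norm_neg, norm_smul, norm_smul, Real.norm_of_nonneg hs0j.le] at h1
    rw [hyq, hpq, norm_smul, Real.norm_of_nonneg hs0j.le] at h2
    have hcomb : s j • (p - z - u j) = (1 - s j) • -(s j • u j) + s j • (p - z - s j • u j) := by
      module
    have hself : ⟪s j • (p - z - u j), s j • (p - z - u j)⟫ =
        (1 - s j) * ⟪s j • (p - z - u j), -(s j • u j)⟫ +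
          s j * ⟪s j • (p - z - u j), p - z - s j • u j⟫ := by
      rw [← real_inner_smul_right, ← real_inner_smul_right, ← inner_add_right, ← hcomb]
    rw [real_inner_self_eq_norm_sq, norm_smul, Real.norm_of_nonneg hs0j.le] at hself
    rcases (norm_nonneg (p - z - u j)).eq_or_lt with he | he
    · rw [← he]
      have := sub_nonneg.2 hs1j
      positivity
    · have hU : ‖u j‖ ^ 2 ≤ (2 * ‖p - z‖) ^ 2 := pow_le_pow_left₀ (norm_nonneg _) hubj 2
      have h1' := mul_le_mul_of_nonneg_left h1 (sub_nonneg.2 hs1j)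
      have h2' := mul_le_mul_of_nonneg_left h2 hs0j.le
      have hU' := mul_le_mul_of_nonneg_left hU (mul_nonneg (sub_nonneg.2 hs1j) hs0j.le)
      have hpos : 0 < s j ^ 2 * ‖p - z - u j‖ := by positivity
      have hmain : s j ^ 2 * ‖p - z - u j‖ * ‖p - z - u j‖ ≤ s j ^ 2 * ‖p - z - u j‖ *
          (((1 - s j) * s j * ‖u j‖ ^ 2 + ‖p - z - s j • u j‖ ^ 2) / 2) := by
        linarith
      linarith [le_of_mul_le_mul_left hmain hpos]

end PositiveReach

theorem Finset.exists_separated_subset_cover {α : Type*} [PseudoMetricSpace α] (A : Finset α)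
    {δ : ℝ} (hδ : 0 ≤ δ) :
    ∃ S ⊆ A, (∀ a ∈ S, ∀ b ∈ S, a ≠ b → δ < dist a b) ∧ ∀ a ∈ A, ∃ s ∈ S, dist a s ≤ δ := by
  classical
  induction A using Finset.induction_on with
  | empty => exact ⟨∅, subset_rfl, by simp, by simp⟩
  | insert a A _ ih =>
    obtain ⟨S, hSA, hsep, hcov⟩ := ih
    by_cases h : ∃ s ∈ S, dist a s ≤ δ
    · refine ⟨S, hSA.trans (Finset.subset_insert a A), hsep, fun b hb => ?_⟩
      rcases Finset.mem_insert.1 hb with rfl | hb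
      exacts [h, hcov b hb]
    · push Not at h
      refine ⟨insert a S, Finset.insert_subset_insert a hSA, fun b hb c hc hbc => ?_,
        fun b hb => ?_⟩
      · rw [Finset.mem_insert] at hb hc
        rcases hb with rfl | hb <;> rcases hc with rfl | hc
        · exact absurd rfl hbc
        · exact h c hc
        · rw [dist_comm]
          exact h b hb
        · exact hsep b hb c hc hbc
      · rcases Finset.mem_insert.1 hb with rfl | hb
        · exact ⟨b, Finset.mem_insert_self b S, by simpa using hδ⟩
        · obtain ⟨s, hs, hbs⟩ := hcov b hb
          exact ⟨s, Finset.mem_insert_of_mem hs, hbs⟩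

/-- Volume bound on the size of a `δ`-separated subset of a ball of radius `r`. -/
theorem Finset.card_le_of_separated_of_subset_closedBall {F : Type*} [NormedAddCommGroup F]
    [NormedSpace ℝ F] [FiniteDimensional ℝ F] (S : Finset F) (c : F) {r δ : ℝ} (hr : 0 ≤ r)
    (hδ : 0 < δ) (hS : ∀ s ∈ S, dist s c ≤ r)
    (hsep : ∀ a ∈ S, ∀ b ∈ S, a ≠ b → δ ≤ dist a b) :
    (S.card : ℝ) ≤ (2 * r / δ + 1) ^ Module.finrank ℝ F := by
  borelize F
  let μ : MeasureTheory.Measure F := MeasureTheory.Measure.addHaar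
  have hδ2 : 0 < δ / 2 := by positivity
  have hρ : 0 < r + δ / 2 := by positivity
  have hdisj : Set.Pairwise (S : Set F) (Function.onFun Disjoint fun s => ball s (δ / 2)) := by
    intro a ha b hb hab
    exact ball_disjoint_ball (by linarith [hsep a ha b hb hab])
  have hsub : (⋃ s ∈ S, ball s (δ / 2)) ⊆ ball c (r + δ / 2) :=
    iUnion₂_subset fun s hs => ball_subset_ball' (by linarith [hS s hs])
  have hvol : (S.card : ENNReal) * ENNReal.ofReal ((δ / 2) ^ Module.finrank ℝ F) * μ (ball 0 1) ≤
      ENNReal.ofReal ((r + δ / 2) ^ Module.finrank ℝ F) * μ (ball 0 1) := by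
    rw [← μ.addHaar_ball_of_pos c hρ]
    refine le_trans (le_of_eq ?_) (MeasureTheory.measure_mono hsub)
    rw [MeasureTheory.measure_biUnion_finset hdisj fun s _ => measurableSet_ball]
    simp only [μ.addHaar_ball_of_pos _ hδ2, Finset.sum_const, nsmul_eq_mul, mul_assoc]
  have hcard := ENNReal.toReal_le_of_le_ofReal (pow_nonneg hρ.le _)
    ((ENNReal.mul_le_mul_iff_left (measure_ball_pos _ _ zero_lt_one).ne'
      MeasureTheory.measure_ball_lt_top.ne).1 hvol)
  rw [ENNReal.toReal_mul, ENNReal.toReal_natCast, ENNReal.toReal_ofReal (by positivity),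
    ← le_div_iff₀ (by positivity), ← div_pow] at hcard
  refine hcard.trans_eq ?_
  congr 1
  field_simp

theorem eq_of_dist_eq_infDist_of_medialAxis {d : ℕ} {M : Set (EuclideanSpace ℝ (Fin d))}
    (hreach : ∀ x ∈ medialAxis M, ∀ z ∈ M, 1 ≤ dist x z) (x : EuclideanSpace ℝ (Fin d))
    (hx : infDist x M < 1) (y : EuclideanSpace ℝ (Fin d)) (hy : y ∈ M)
    (z : EuclideanSpace ℝ (Fin d)) (hz : z ∈ M) (hxy : dist x y = infDist x M)
    (hxz : dist x z = infDist x M) : y = z := by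
  by_contra hne
  have := hreach x (subset_closure ⟨y, hy, z, hz, hne, hxy, hxz⟩) y hy
  linarith

/-- If `P` is a uniform `(ε,κ)`-sample of a compact smooth `m`-manifold
`M ⊆ ℝ^d` with reach at least 1, then for any `x ∈ ℝ^d` and any `t ∈ [1, 1/√(2ε)]`, the
number of points of `P` in the closed ball `B(x, tε)` is at most `(4t+1)^m · κ`. -/
theorem stmt1 (d m κ : ℕ) (ε : ℝ) (hε : 0 < ε)
    (M : Set (EuclideanSpace ℝ (Fin d)))
    (hMne : M.Nonempty) (hMc : IsCompact M)
    (T : EuclideanSpace ℝ (Fin d) → Submodule ℝ (EuclideanSpace ℝ (Fin d)))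
    (hT : ∀ z ∈ M, (T z : Set (EuclideanSpace ℝ (Fin d))) = tangentConeAt ℝ M z)
    (hTm : ∀ z ∈ M, Module.finrank ℝ (T z) = m)
    (hreach : ∀ x ∈ medialAxis M, ∀ z ∈ M, 1 ≤ dist x z)
    (P : Finset (EuclideanSpace ℝ (Fin d))) (hPM : ↑P ⊆ M)
    (hdense : ∀ z ∈ M, ∃ p ∈ P, dist z p ≤ ε)
    (hκ : ∀ x : EuclideanSpace ℝ (Fin d), (P.filter (fun p => dist x p ≤ ε)).card ≤ κ)
    (x : EuclideanSpace ℝ (Fin d)) (t : ℝ) (ht1 : 1 ≤ t) (ht2 : t ≤ 1 / Real.sqrt (2 * ε)) :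
    ((P.filter (fun p => dist x p ≤ t * ε)).card : ℝ) ≤ (4 * t + 1) ^ m * κ := by
  rcases (P.filter (fun p => dist x p ≤ t * ε)).eq_empty_or_nonempty with hemp | ⟨p₀, hp₀⟩
  · rw [hemp]
    simp only [Finset.card_empty, Nat.cast_zero]
    positivity
  have huniq := eq_of_dist_eq_infDist_of_medialAxis hreach
  set r := t * ε with hr
  have hr0 : 0 < r := by positivity
  have ht2 : t ^ 2 * (2 * ε) ≤ 1 := by
    have h := (le_div_iff₀ (Real.sqrt_pos.2 (by positivity))).1 ht2
    have h' := pow_le_pow_left₀ (by positivity) h 2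
    rwa [mul_pow, Real.sq_sqrt (by positivity), one_pow] at h'
  have hrε : r ^ 2 ≤ ε / 2 := by
    rw [hr]
    nlinarith
  have hε2 : ε ≤ 1 / 2 := by nlinarith
  have hr2 : r ≤ 1 / 2 := by nlinarith
  obtain ⟨z, hz, hxz⟩ := hMc.exists_infDist_eq_dist hMne x
  have hxr : infDist x M ≤ r :=
    (infDist_le_dist_of_mem (hPM (Finset.mem_filter.1 hp₀).1)).trans (Finset.mem_filter.1 hp₀).2
  set K := T z with hK
  set f : EuclideanSpace ℝ (Fin d) → K := fun p => K.orthogonalProjectionOnto (p - z) with hf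
  have hheight : ∀ p ∈ M, dist x p ≤ r → ‖p - z - f p‖ ≤ ε / 2 := by
    intro p hp hxp
    have hin := inner_sub_nearest_le hMc huniq (by linarith) hz hxz.symm hp
    rw [dist_eq_norm] at hxp hxz
    have hxp2 := pow_le_pow_left₀ (norm_nonneg _) hxp 2
    rw [show x - p = (x - z) - (p - z) by abel, norm_sub_sq_real] at hxp2
    have hpz : ‖p - z‖ ^ 2 ≤ 2 * r ^ 2 := by
      nlinarith [sq_nonneg ‖x - z‖, sq_nonneg ‖p - z‖]
    obtain ⟨u, hu, hpu⟩ := exists_mem_tangentConeAt_norm_sub_le hMc huniq hz hp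
    rw [← hT z hz] at hu
    have hmin : ‖p - z - f p‖ ≤ ‖p - z - u‖ := by
      have h := K.starProjection_minimal (p - z)
      rw [Submodule.starProjection_apply] at h
      rw [hf, h]
      exact ciInf_le (f := fun v : K => ‖p - z - v‖)
        ⟨0, by rintro _ ⟨v, rfl⟩; exact norm_nonneg _⟩ ⟨u, hu⟩
    linarith
  classical
  obtain ⟨S, hSf, hsep, hcov⟩ := ((P.filter (fun p => dist x p ≤ r)).image f
    ).exists_separated_subset_cover (δ := ε / 2) (by positivity)
  have hSr : ∀ s ∈ S, dist s (f x) ≤ r := by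
    intro s hs
    obtain ⟨p, hp, rfl⟩ := Finset.mem_image.1 (hSf hs)
    rw [dist_comm, dist_eq_norm, hf, ← map_sub, sub_sub_sub_cancel_right]
    refine (K.norm_orthogonalProjectionOnto_apply_le _).trans ?_
    rw [← dist_eq_norm]
    exact (Finset.mem_filter.1 hp).2
  have hScard := S.card_le_of_separated_of_subset_closedBall (f x) hr0.le (half_pos hε) hSr
    fun a ha b hb hab => (hsep a ha b hb hab).le
  rw [hTm z hz, show 2 * r / (ε / 2) + 1 = 4 * t + 1 by rw [hr]; field_simp; ring] at hScard
  have hsub : P.filter (fun p => dist x p ≤ r) ⊆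
      S.biUnion fun s => P.filter (fun p => dist (z + s) p ≤ ε) := by
    intro p hp
    obtain ⟨hpP, hxp⟩ := Finset.mem_filter.1 hp
    obtain ⟨s, hs, hps⟩ := hcov (f p) (Finset.mem_image_of_mem f hp)
    refine Finset.mem_biUnion.2 ⟨s, hs, Finset.mem_filter.2 ⟨hpP, ?_⟩⟩
    have h1 := hheight p (hPM hpP) hxp
    rw [dist_eq_norm, ← Submodule.norm_coe, Submodule.coe_sub] at hps
    rw [dist_comm, dist_eq_norm, show p - (z + s) = (p - z - f p) + (f p - s) by abel]
    linarith [norm_add_le (p - z - f p : EuclideanSpace ℝ (Fin d)) (f p - s)]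
  have hcard : (P.filter (fun p => dist x p ≤ r)).card ≤ S.card * κ :=
    (Finset.card_le_card hsub).trans (Finset.card_biUnion_le_card_mul _ _ _ fun s _ => hκ _)
  calc ((P.filter (fun p => dist x p ≤ r)).card : ℝ) ≤ S.card * κ := mod_cast hcard
    _ ≤ (4 * t + 1) ^ m * κ := by gcongr
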